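/- Let d ≥ 1, α ∈ (0,2), r₀ > 0, and let u : ℝ^d → ℝ be bounded and twice continuously differentiable with bounded second derivatives. Then for every x ∈ ℝ^d, (1/2) ∫_{ℝ^d} (2u(x) − u(x−y) − u(x+y)) ‖y‖^{−(d+α)} dy = (|S^{d−1}| r₀^{2−α} / (2(2−α))) ∫_{S^{d−1}} ∫_0^1 [(2u(x) − u(x − r₀ s ξ) − u(x + r₀ s ξ)) / (r₀ s)²] (2−α) s^{1−α} ds dσ̄(ξ) + (|S^{d−1}| r₀^{−α} / (2α)) ∫_{S^{d−1}} ∫_0^1 (2u(x) − u(x − (r₀/v) ξ) − u(x + (r₀/v) ξ)) α v^{α−1} dv dσ̄(ξ), where σ is the surface measure on the unit sphere S^{d−1}, |S^{d−1}| = σ(S^{d−1}) = 2π^{d/2}/Γ(d/2), and σ̄ = σ/|S^{d−1}|. -/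

import Mathlib

open MeasureTheory Real Set

/-- The surface measure on the unit sphere `S^{d-1} ⊂ ℝ^d`. -/
noncomputable def surfaceMeasure (d : ℕ) :
    Measure (Metric.sphere (0 : EuclideanSpace ℝ (Fin d)) 1) :=
  (volume : Measure (EuclideanSpace ℝ (Fin d))).toSphere

/-- `|S^{d-1}| = 2 π^{d/2} / Γ(d/2)`, the total surface measure of the unit sphere. -/
noncomputable def sphereArea (d : ℕ) : ℝ :=
  2 * Real.pi ^ ((d : ℝ) / 2) / Real.Gamma ((d : ℝ) / 2)

/-- `σ̄ = σ / |S^{d-1}|`, the uniform probability measure on the unit sphere. -/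
noncomputable def uniformSphere (d : ℕ) :
    Measure (Metric.sphere (0 : EuclideanSpace ℝ (Fin d)) 1) :=
  (ENNReal.ofReal (sphereArea d))⁻¹ • surfaceMeasure d

/-- Integration in polar coordinates on a finite-dimensional normed space. -/
theorem integral_eq_integral_toSphere_integral_Ioi {E : Type*} [NormedAddCommGroup E]
    [NormedSpace ℝ E] [MeasurableSpace E] [BorelSpace E] [FiniteDimensional ℝ E] [Nontrivial E]
    (μ : Measure E) [μ.IsAddHaarMeasure] {F : E → ℝ} (hF : Integrable F μ) :
    ∫ y, F y ∂μ = ∫ ξ : Metric.sphere (0 : E) 1,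
      (∫ r in Ioi (0 : ℝ), r ^ (Module.finrank ℝ E - 1) * F (r • (ξ : E))) ∂μ.toSphere := by
  let e := homeomorphUnitSphereProd E
  have hmp := μ.measurePreserving_homeomorphUnitSphereProd
  have hcomp : ∀ z : ({(0 : E)}ᶜ : Set E),
      F (((e z).2 : ℝ) • ((e z).1 : E)) = F z := by
    intro z
    congr 1
    have : ((e.symm (e z)) : E) = ((e z).2 : ℝ) • ((e z).1 : E) := rfl
    rw [← this, e.symm_apply_apply]
  have hint : Integrable (fun p : Metric.sphere (0 : E) 1 × Ioi (0 : ℝ) =>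
      F ((p.2 : ℝ) • (p.1 : E)))
      (μ.toSphere.prod (.volumeIoiPow (Module.finrank ℝ E - 1))) := by
    rw [← hmp.integrable_comp_emb e.measurableEmbedding]
    have : ((fun p : Metric.sphere (0 : E) 1 × Ioi (0 : ℝ) => F ((p.2 : ℝ) • (p.1 : E))) ∘ e)
        = fun z : ({(0 : E)}ᶜ : Set E) => F z := funext hcomp
    change Integrable (_ ∘ e) _
    rw [this]
    exact (integrableOn_iff_comap_subtypeVal (measurableSet_singleton _).compl).1
      hF.integrableOn
  calc
    ∫ y, F y ∂μ = ∫ z : ({(0 : E)}ᶜ : Set E), F z ∂(μ.comap (↑)) := by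
      rw [integral_subtype_comap (measurableSet_singleton _).compl F,
        restrict_compl_singleton]
    _ = ∫ p, F ((p.2 : ℝ) • (p.1 : E))
          ∂μ.toSphere.prod (.volumeIoiPow (Module.finrank ℝ E - 1)) := by
      rw [← hmp.integral_comp e.measurableEmbedding]
      exact integral_congr_ae (.of_forall fun z => (hcomp z).symm)
    _ = ∫ ξ : Metric.sphere (0 : E) 1, (∫ r : Ioi (0 : ℝ), F ((r : ℝ) • (ξ : E))
          ∂(Measure.volumeIoiPow (Module.finrank ℝ E - 1))) ∂μ.toSphere :=
      integral_prod _ hint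
    _ = _ := by
      refine integral_congr_ae (.of_forall fun ξ => ?_)
      simp only [Measure.volumeIoiPow, ENNReal.ofReal]
      rw [integral_withDensity_eq_integral_smul,
        integral_subtype_comap measurableSet_Ioi
          fun a ↦ Real.toNNReal (a ^ (Module.finrank ℝ E - 1)) • F (a • (ξ : E)),
        setIntegral_congr_fun measurableSet_Ioi fun r hr ↦ ?_]
      · rw [NNReal.smul_def, Real.coe_toNNReal _ (pow_nonneg hr.out.le _), smul_eq_mul]
      · exact (measurable_subtype_coe.pow_const _).real_toNNReal

/-- Integration in polar coordinates over a set of vectors with prescribed norms. -/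
theorem setIntegral_norm_mem_eq_integral_toSphere {E : Type*} [NormedAddCommGroup E]
    [NormedSpace ℝ E] [MeasurableSpace E] [BorelSpace E] [FiniteDimensional ℝ E] [Nontrivial E]
    (μ : Measure E) [μ.IsAddHaarMeasure] {F : E → ℝ} (hF : Integrable F μ) {S : Set ℝ}
    (hS : MeasurableSet S) :
    ∫ y in norm ⁻¹' S, F y ∂μ = ∫ ξ : Metric.sphere (0 : E) 1,
      (∫ r in Ioi (0 : ℝ) ∩ S, r ^ (Module.finrank ℝ E - 1) * F (r • (ξ : E))) ∂μ.toSphere := by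
  have hS' : MeasurableSet (norm ⁻¹' S : Set E) := measurable_norm hS
  rw [← integral_indicator hS',
    integral_eq_integral_toSphere_integral_Ioi μ (hF.indicator hS')]
  refine integral_congr_ae (.of_forall fun ξ => ?_)
  simp only
  rw [← setIntegral_indicator hS]
  refine setIntegral_congr_fun measurableSet_Ioi fun r hr => ?_
  have hr : 0 < r := hr
  have hn : ‖r • (ξ : E)‖ = r := by simp [norm_smul, abs_of_pos hr]
  by_cases h : r ∈ S <;> simp [indicator, h, hn]

/-- A function with bounded second derivative has quadratically small second differences. -/
theorem abs_second_difference_le {E : Type*} [NormedAddCommGroup E] [NormedSpace ℝ E]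
    {u : E → ℝ} (hu : ContDiff ℝ 2 u) {C : ℝ} (hC : ∀ z, ‖iteratedFDeriv ℝ 2 u z‖ ≤ C) (x y : E) :
    |2 * u x - u (x - y) - u (x + y)| ≤ 2 * C * ‖y‖ ^ 2 := by
  have hd : Differentiable ℝ u := hu.differentiable (by norm_num)
  have hd2 : Differentiable ℝ (fderiv ℝ u) :=
    (hu.fderiv_right (m := 1) (by norm_num)).differentiable (by norm_num)
  have hbound : ∀ z, ‖fderiv ℝ (fderiv ℝ u) z‖ ≤ C := fun z => by
    rw [← norm_iteratedFDeriv_one, norm_iteratedFDeriv_fderiv]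
    exact hC z
  have hC0 : 0 ≤ C := (norm_nonneg _).trans (hC 0)
  have hlip : ∀ a b, ‖fderiv ℝ u b - fderiv ℝ u a‖ ≤ C * ‖b - a‖ := fun a b =>
    convex_univ.norm_image_sub_le_of_norm_fderiv_le (fun z _ => hd2 z) (fun z _ => hbound z)
      (mem_univ a) (mem_univ b)
  have hderiv : ∀ z, HasFDerivAt (fun z => u (x - z) + u (x + z))
      (fderiv ℝ u (x + z) - fderiv ℝ u (x - z)) z := by
    intro z
    have h1 : HasFDerivAt (fun z => u (x - z)) (-fderiv ℝ u (x - z)) z := by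
      simpa [Function.comp_def] using
        (hd (x - z)).hasFDerivAt.comp z ((hasFDerivAt_id z).const_sub x)
    have h2 : HasFDerivAt (fun z => u (x + z)) (fderiv ℝ u (x + z)) z := by
      simpa [Function.comp_def] using
        (hd (x + z)).hasFDerivAt.comp z ((hasFDerivAt_id z).const_add x)
    rw [sub_eq_neg_add]
    exact h1.add h2
  have key := (convex_closedBall (0 : E) ‖y‖).norm_image_sub_le_of_norm_hasFDerivWithin_le
    (C := C * (2 * ‖y‖)) (x := 0) (y := y)
    (fun z _ => (hderiv z).hasFDerivWithinAt) (fun z hz => ?_) (by simp) (by simp)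
  · simp only [sub_zero, add_zero, Real.norm_eq_abs] at key
    rw [abs_sub_comm] at key
    calc |2 * u x - u (x - y) - u (x + y)| = |u x + u x - (u (x - y) + u (x + y))| := by
          congr 1; ring
      _ ≤ _ := key
      _ = _ := by ring
  · refine (hlip _ _).trans ?_
    have hz : ‖z‖ ≤ ‖y‖ := by simpa using hz
    gcongr
    calc ‖x + z - (x - z)‖ = ‖z + z‖ := by congr 1; abel
      _ ≤ ‖z‖ + ‖z‖ := norm_add_le _ _
      _ ≤ 2 * ‖y‖ := by linarith

theorem pow_pred_mul_rpow_neg_add {d : ℕ} (hd : 1 ≤ d) (α : ℝ) {r : ℝ} (hr : 0 < r) :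
    r ^ (d - 1) * r ^ (-((d : ℝ) + α)) = r ^ (-1 - α) := by
  rw [← Real.rpow_natCast, ← Real.rpow_add hr, Nat.cast_sub hd]
  congr 1
  push_cast
  ring

/-- A continuous bounded function vanishing quadratically at the origin is integrable against
the singular kernel `‖y‖ ^ (-(d + α))` for `0 < α < 2`. -/
theorem integrable_mul_norm_rpow {d : ℕ} (hd : 1 ≤ d) {α : ℝ} (hα : α ∈ Set.Ioo (0 : ℝ) 2)
    {g : EuclideanSpace ℝ (Fin d) → ℝ} (hg : Continuous g) {A B : ℝ}
    (hA : ∀ y, |g y| ≤ A * ‖y‖ ^ 2) (hB : ∀ y, |g y| ≤ B) :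
    Integrable fun y => g y * ‖y‖ ^ (-((d : ℝ) + α)) := by
  have : NeZero d := ⟨by omega⟩
  have hα0 := hα.1
  have hα2 := hα.2
  let f : ℝ → ℝ := fun r => min (A * r ^ 2) B * r ^ (-((d : ℝ) + α))
  have hf : Measurable f := by fun_prop
  have hdom : Integrable (fun y : EuclideanSpace ℝ (Fin d) => f ‖y‖) := by
    rw [integrable_fun_norm_addHaar]
    simp only [finrank_euclideanSpace, Fintype.card_fin, smul_eq_mul]
    have hfr : ∀ r : ℝ, 0 < r → r ^ (d - 1) * f r = min (A * r ^ 2) B * r ^ (-1 - α) := by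
      intro r hr
      rw [← pow_pred_mul_rpow_neg_add hd α hr]
      ring
    have hmin : ∀ r : ℝ, 0 < r → 0 ≤ min (A * r ^ 2) B := by
      intro r hr
      let y : EuclideanSpace ℝ (Fin d) := EuclideanSpace.single 0 r
      have hy : ‖y‖ = r := by simp [y, abs_of_pos hr]
      exact le_min (by simpa [hy] using (abs_nonneg _).trans (hA y))
        ((abs_nonneg _).trans (hB y))
    have hm : Measurable fun r : ℝ => r ^ (d - 1) * f r := by fun_prop
    rw [← Ioc_union_Ioi_eq_Ioi (zero_le_one' ℝ), integrableOn_union]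
    constructor
    · have hi : IntegrableOn (fun r : ℝ => A * r ^ (1 - α)) (Ioc 0 1) :=
        ((intervalIntegrable_iff_integrableOn_Ioc_of_le zero_le_one).1
          (intervalIntegral.intervalIntegrable_rpow' (by linarith))).const_mul A
      refine hi.mono' hm.aestronglyMeasurable ?_
      filter_upwards [ae_restrict_mem measurableSet_Ioc] with r hr
      have hr0 := hr.1
      rw [hfr r hr0, Real.norm_eq_abs,
        abs_of_nonneg (mul_nonneg (hmin r hr0) (Real.rpow_nonneg hr0.le _))]
      calc min (A * r ^ 2) B * r ^ (-1 - α) ≤ A * r ^ 2 * r ^ (-1 - α) := by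
            gcongr; exact min_le_left _ _
        _ = A * r ^ (1 - α) := by
            rw [mul_assoc, ← Real.rpow_natCast, ← Real.rpow_add hr0]
            norm_num
            left; congr 1; ring
    · have hi : IntegrableOn (fun r : ℝ => B * r ^ (-1 - α)) (Ioi 1) :=
        (integrableOn_Ioi_rpow_of_lt (by linarith) one_pos).const_mul B
      refine hi.mono' hm.aestronglyMeasurable ?_
      filter_upwards [ae_restrict_mem measurableSet_Ioi] with r hr
      have hr0 : 0 < r := one_pos.trans hr
      rw [hfr r hr0, Real.norm_eq_abs,
        abs_of_nonneg (mul_nonneg (hmin r hr0) (Real.rpow_nonneg hr0.le _))]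
      gcongr
      exact min_le_right _ _
  refine hdom.mono' (hg.measurable.mul (measurable_norm.pow_const _)).aestronglyMeasurable
    (.of_forall fun y => ?_)
  rw [norm_mul, Real.norm_eq_abs, Real.norm_of_nonneg (Real.rpow_nonneg (norm_nonneg _) _)]
  exact mul_le_mul_of_nonneg_right (le_min (hA y) (hB y)) (Real.rpow_nonneg (norm_nonneg _) _)

theorem setIntegral_Ioo_eq_mul_setIntegral_Ioo_zero_one (h : ℝ → ℝ) {r₀ : ℝ} (hr₀ : 0 < r₀) :
    ∫ r in Ioo 0 r₀, h r = ∫ s in Ioo (0 : ℝ) 1, r₀ * h (r₀ * s) := by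
  rw [integral_const_mul, ← integral_Ioc_eq_integral_Ioo, ← integral_Ioc_eq_integral_Ioo,
    ← intervalIntegral.integral_of_le hr₀.le, ← intervalIntegral.integral_of_le zero_le_one,
    intervalIntegral.mul_integral_comp_mul_left]
  simp

theorem setIntegral_Ioi_eq_setIntegral_Ioo_zero_one (h : ℝ → ℝ) {r₀ : ℝ} (hr₀ : 0 < r₀) :
    ∫ r in Ioi r₀, h r = ∫ v in Ioo (0 : ℝ) 1, r₀ / v ^ 2 * h (r₀ / v) := by
  have himage : (fun v : ℝ => r₀ / v) '' Ioo 0 1 = Ioi r₀ := by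
    ext r
    simp only [mem_image, mem_Ioo, mem_Ioi]
    constructor
    · rintro ⟨v, ⟨hv0, hv1⟩, rfl⟩
      rw [lt_div_iff₀ hv0]
      nlinarith
    · intro hr
      have hr0 : 0 < r := hr₀.trans hr
      refine ⟨r₀ / r, ⟨div_pos hr₀ hr0, (div_lt_one hr0).2 hr⟩, ?_⟩
      field_simp
  have hderiv : ∀ v ∈ Ioo (0 : ℝ) 1,
      HasDerivWithinAt (fun v : ℝ => r₀ / v) (-(r₀ / v ^ 2)) (Ioo 0 1) v := by
    intro v hv
    simpa only [mul_neg, ← div_eq_mul_inv] using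
      ((hasDerivAt_inv hv.1.ne').const_mul r₀).hasDerivWithinAt (s := Ioo (0 : ℝ) 1)
  have hinj : InjOn (fun v : ℝ => r₀ / v) (Ioo 0 1) := by
    intro v hv w hw hvw
    have hv0 := hv.1
    have hw0 := hw.1
    simp only at hvw
    field_simp at hvw
    exact hvw.symm
  rw [← himage, integral_image_eq_integral_abs_deriv_smul measurableSet_Ioo hderiv hinj]
  refine setIntegral_congr_fun measurableSet_Ioo fun v hv => ?_
  have hv0 := hv.1
  simp only [abs_neg, smul_eq_mul]
  rw [abs_of_pos (by positivity)]

theorem sphereArea_pos {d : ℕ} (hd : 1 ≤ d) : 0 < sphereArea d := by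
  have hd' : (0 : ℝ) < d := by exact_mod_cast hd
  have := Real.Gamma_pos_of_pos (half_pos hd')
  unfold sphereArea
  positivity

theorem sphereArea_mul_integral_uniformSphere {d : ℕ} (hd : 1 ≤ d)
    (f : Metric.sphere (0 : EuclideanSpace ℝ (Fin d)) 1 → ℝ) :
    sphereArea d * ∫ ξ, f ξ ∂(uniformSphere d) = ∫ ξ, f ξ ∂(surfaceMeasure d) := by
  have h := sphereArea_pos hd
  rw [uniformSphere, integral_smul_measure, ENNReal.toReal_inv, ENNReal.toReal_ofReal h.le,
    smul_eq_mul, mul_inv_cancel_left₀ h.ne']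

theorem stmt_9 {d : ℕ} (hd : 1 ≤ d) {α r₀ : ℝ} (hα : α ∈ Set.Ioo (0 : ℝ) 2) (hr₀ : 0 < r₀)
    {u : EuclideanSpace ℝ (Fin d) → ℝ} (hu : ContDiff ℝ 2 u)
    (hM : ∃ M, ∀ z, |u z| ≤ M)
    (hC : ∃ C, ∀ z, ‖iteratedFDeriv ℝ 2 u z‖ ≤ C)
    (x : EuclideanSpace ℝ (Fin d)) :
    (1 / 2) * (∫ y : EuclideanSpace ℝ (Fin d),
        (2 * u x - u (x - y) - u (x + y)) * ‖y‖ ^ (-((d : ℝ) + α))) =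
      (sphereArea d * r₀ ^ (2 - α) / (2 * (2 - α))) *
        (∫ ξ : Metric.sphere (0 : EuclideanSpace ℝ (Fin d)) 1,
          (∫ s in Set.Ioo (0 : ℝ) 1,
            ((2 * u x - u (x - (r₀ * s) • (ξ : EuclideanSpace ℝ (Fin d)))
                - u (x + (r₀ * s) • (ξ : EuclideanSpace ℝ (Fin d)))) / (r₀ * s) ^ 2) *
              ((2 - α) * s ^ (1 - α)))
          ∂(uniformSphere d))
      + (sphereArea d * r₀ ^ (-α) / (2 * α)) *
        (∫ ξ : Metric.sphere (0 : EuclideanSpace ℝ (Fin d)) 1,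
          (∫ v in Set.Ioo (0 : ℝ) 1,
            (2 * u x - u (x - (r₀ / v) • (ξ : EuclideanSpace ℝ (Fin d)))
                - u (x + (r₀ / v) • (ξ : EuclideanSpace ℝ (Fin d)))) * (α * v ^ (α - 1)))
          ∂(uniformSphere d)) := by
  obtain ⟨M, hM⟩ := hM
  obtain ⟨C, hC⟩ := hC
  have hα0 : 0 < α := hα.1
  have hα2 : 0 < 2 - α := sub_pos.2 hα.2
  have : NeZero d := ⟨by omega⟩
  have hF : Integrable fun y : EuclideanSpace ℝ (Fin d) =>
      (2 * u x - u (x - y) - u (x + y)) * ‖y‖ ^ (-((d : ℝ) + α)) := by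
    have huc := hu.continuous
    refine integrable_mul_norm_rpow hd hα (g := fun y => 2 * u x - u (x - y) - u (x + y))
      (by fun_prop) (A := 2 * C) (B := 4 * M) (fun y => abs_second_difference_le hu hC x y)
      (fun y => ?_)
    have h1 := abs_le.1 (hM x)
    have h2 := abs_le.1 (hM (x - y))
    have h3 := abs_le.1 (hM (x + y))
    exact abs_le.2 ⟨by linarith, by linarith⟩
  have hinside := setIntegral_norm_mem_eq_integral_toSphere volume hF
    (measurableSet_Iio (a := r₀))
  have houtside := setIntegral_norm_mem_eq_integral_toSphere volume hF
    (measurableSet_Iio (a := r₀)).compl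
  have hset : Ioi (0 : ℝ) ∩ (Iio r₀)ᶜ = Ici r₀ := by
    ext r
    simp only [mem_inter_iff, mem_Ioi, mem_compl_iff, mem_Iio, not_lt, mem_Ici]
    exact ⟨And.right, fun h => ⟨hr₀.trans_le h, h⟩⟩
  have hkernel : ∀ ξ : Metric.sphere (0 : EuclideanSpace ℝ (Fin d)) 1, ∀ r : ℝ, 0 < r →
      r ^ (d - 1) * ((2 * u x - u (x - r • (ξ : EuclideanSpace ℝ (Fin d)))
        - u (x + r • (ξ : EuclideanSpace ℝ (Fin d)))) *
          ‖r • (ξ : EuclideanSpace ℝ (Fin d))‖ ^ (-((d : ℝ) + α))) =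
      (2 * u x - u (x - r • (ξ : EuclideanSpace ℝ (Fin d)))
        - u (x + r • (ξ : EuclideanSpace ℝ (Fin d)))) * r ^ (-1 - α) := by
    intro ξ r hr
    have hn : ‖r • (ξ : EuclideanSpace ℝ (Fin d))‖ = r := by simp [norm_smul, abs_of_pos hr]
    rw [hn, ← pow_pred_mul_rpow_neg_add hd α hr]
    ring
  rw [Ioi_inter_Iio] at hinside
  rw [hset, preimage_compl] at houtside
  simp only [finrank_euclideanSpace, Fintype.card_fin] at hinside houtside
  have hA : ∀ ξ : Metric.sphere (0 : EuclideanSpace ℝ (Fin d)) 1,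
      ∫ r in Ioo 0 r₀, r ^ (d - 1) * ((2 * u x - u (x - r • (ξ : EuclideanSpace ℝ (Fin d)))
        - u (x + r • (ξ : EuclideanSpace ℝ (Fin d)))) *
          ‖r • (ξ : EuclideanSpace ℝ (Fin d))‖ ^ (-((d : ℝ) + α))) =
      r₀ ^ (2 - α) / (2 - α) * ∫ s in Set.Ioo (0 : ℝ) 1,
            ((2 * u x - u (x - (r₀ * s) • (ξ : EuclideanSpace ℝ (Fin d)))
                - u (x + (r₀ * s) • (ξ : EuclideanSpace ℝ (Fin d)))) / (r₀ * s) ^ 2) *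
              ((2 - α) * s ^ (1 - α)) := by
    intro ξ
    rw [setIntegral_Ioo_eq_mul_setIntegral_Ioo_zero_one _ hr₀, ← integral_const_mul]
    refine setIntegral_congr_fun measurableSet_Ioo fun s hs => ?_
    have hs0 : 0 < s := hs.1
    rw [hkernel ξ _ (mul_pos hr₀ hs0), Real.mul_rpow hr₀.le hs0.le,
      show -1 - α = (1 - α) - (2 : ℕ) by push_cast; ring, Real.rpow_sub_natCast hs0.ne',
      show (1 - α) - ((2 : ℕ) : ℝ) = (2 - α) - (3 : ℕ) by push_cast; ring,
      Real.rpow_sub_natCast hr₀.ne']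
    field_simp
  have hB : ∀ ξ : Metric.sphere (0 : EuclideanSpace ℝ (Fin d)) 1,
      ∫ r in Ici r₀, r ^ (d - 1) * ((2 * u x - u (x - r • (ξ : EuclideanSpace ℝ (Fin d)))
        - u (x + r • (ξ : EuclideanSpace ℝ (Fin d)))) *
          ‖r • (ξ : EuclideanSpace ℝ (Fin d))‖ ^ (-((d : ℝ) + α))) =
      r₀ ^ (-α) / α * ∫ v in Set.Ioo (0 : ℝ) 1,
            (2 * u x - u (x - (r₀ / v) • (ξ : EuclideanSpace ℝ (Fin d)))
                - u (x + (r₀ / v) • (ξ : EuclideanSpace ℝ (Fin d)))) * (α * v ^ (α - 1)) := by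
    intro ξ
    rw [integral_Ici_eq_integral_Ioi, setIntegral_Ioi_eq_setIntegral_Ioo_zero_one _ hr₀,
      ← integral_const_mul]
    refine setIntegral_congr_fun measurableSet_Ioo fun v hv => ?_
    have hv0 : 0 < v := hv.1
    rw [hkernel ξ _ (div_pos hr₀ hv0), Real.div_rpow hr₀.le hv0.le,
      show -1 - α = -α - (1 : ℕ) by push_cast; ring, Real.rpow_sub_natCast hr₀.ne',
      show -α - ((1 : ℕ) : ℝ) = -((α - 1) + (2 : ℕ)) by push_cast; ring,
      Real.rpow_neg hv0.le, Real.rpow_add_natCast hv0.ne']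
    field_simp
  simp only [hA, integral_const_mul] at hinside
  simp only [hB, integral_const_mul] at houtside
  rw [← integral_add_compl (measurable_norm (measurableSet_Iio (a := r₀))) hF, hinside, houtside]
  change 1 / 2 * (_ * ∫ ξ, _ ∂(surfaceMeasure d) + _ * ∫ ξ, _ ∂(surfaceMeasure d)) = _
  rw [← sphereArea_mul_integral_uniformSphere hd, ← sphereArea_mul_integral_uniformSphere hd]
  field_simp
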